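/- Let d be a soft metric on X with parameter set E, let S ⊆ X × E, and let p be a soft point. Then p belongs to the soft closure of S if and only if for every positive ε : E → ℝ there exists q ∈ S with d p q e < ε e for all e ∈ E (i.e. the soft distance from p to S is 0̄). -/

import Mathlib

/-- A soft metric on `X` with parameter set `E`. -/
def IsSoftMetric {X E : Type*} (d : X × E → X × E → E → ℝ) : Prop :=
  (∀ p q : X × E, ∀ e : E, 0 ≤ d p q e) ∧
  (∀ p q : X × E, (∀ e : E, d p q e = 0) ↔ p = q) ∧
  (∀ p q : X × E, d p q = d q p) ∧
  (∀ p q r : X × E, ∀ e : E, d p r e ≤ d p q e + d q r e)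

/-- The soft open ball of center `p` and radius `ε`. -/
def SoftBall {X E : Type*} (d : X × E → X × E → E → ℝ) (p : X × E) (ε : E → ℝ) :
    Set (X × E) :=
  {q | ∀ e : E, d p q e < ε e}

/-- A set is soft open if every point has a soft ball around it inside the set. -/
def SoftOpen {X E : Type*} (d : X × E → X × E → E → ℝ) (U : Set (X × E)) : Prop :=
  ∀ p ∈ U, ∃ ε : E → ℝ, (∀ e : E, 0 < ε e) ∧ SoftBall d p ε ⊆ U

/-- A set is soft closed if its complement is soft open. -/
def SoftClosed {X E : Type*} (d : X × E → X × E → E → ℝ) (C : Set (X × E)) : Prop :=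
  SoftOpen d Cᶜ

/-- The soft closure of a set: intersection of all soft closed supersets. -/
def SoftClosure {X E : Type*} (d : X × E → X × E → E → ℝ) (S : Set (X × E)) :
    Set (X × E) :=
  ⋂₀ {C | SoftClosed d C ∧ S ⊆ C}

/-- The soft interior of a set: union of all soft open subsets. -/
def SoftInterior {X E : Type*} (d : X × E → X × E → E → ℝ) (S : Set (X × E)) :
    Set (X × E) :=
  ⋃₀ {U | SoftOpen d U ∧ U ⊆ S}

/-- Soft continuity of `g` at the soft point `p`. -/
def SoftContinuousAt {X E Y E' : Type*} (d : X × E → X × E → E → ℝ)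
    (ρ : Y × E' → Y × E' → E' → ℝ) (g : X × E → Y × E') (p : X × E) : Prop :=
  ∀ ε : E' → ℝ, (∀ e' : E', 0 < ε e') → ∃ δ : E → ℝ, (∀ e : E, 0 < δ e) ∧
    ∀ q : X × E, (∀ e : E, d p q e < δ e) → (∀ e' : E', ρ (g p) (g q) e' < ε e')

/-- Soft convergence of a sequence of soft points. -/
def SoftTendsto {X E : Type*} (d : X × E → X × E → E → ℝ) (s : ℕ → X × E)
    (p : X × E) : Prop :=
  ∀ ε : E → ℝ, (∀ e : E, 0 < ε e) → ∃ N : ℕ, ∀ n ≥ N, ∀ e : E, d (s n) p e < ε e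

/-- A soft Cauchy sequence. -/
def SoftCauchy {X E : Type*} (d : X × E → X × E → E → ℝ) (s : ℕ → X × E) : Prop :=
  ∀ ε : E → ℝ, (∀ e : E, 0 < ε e) → ∃ N : ℕ, ∀ m ≥ N, ∀ n ≥ N, ∀ e : E,
    d (s m) (s n) e < ε e

/-- Completeness of the soft metric space. -/
def SoftComplete {X E : Type*} (d : X × E → X × E → E → ℝ) : Prop :=
  ∀ s : ℕ → X × E, SoftCauchy d s → ∃ p : X × E, SoftTendsto d s p

theorem softOpen_softBall {X E : Type*} {d : X × E → X × E → E → ℝ} (hd : IsSoftMetric d)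
    (p : X × E) (ε : E → ℝ) : SoftOpen d (SoftBall d p ε) := by
  intro q hq
  refine ⟨fun e => ε e - d p q e, fun e => sub_pos.2 (hq e), fun r hr e => ?_⟩
  linarith [hd.2.2.2 p q r e, hr e]

/-- membership in the soft closure is the distance-zero condition. -/
theorem mem_softClosure_iff {X E : Type*} [Nonempty X] [Nonempty E]
    (d : X × E → X × E → E → ℝ) (hd : IsSoftMetric d) (S : Set (X × E)) (p : X × E) :
    p ∈ SoftClosure d S ↔
      ∀ ε : E → ℝ, (∀ e : E, 0 < ε e) → ∃ q ∈ S, ∀ e : E, d p q e < ε e := by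
  constructor
  · intro hp ε hε
    by_contra! h
    refine hp (SoftBall d p ε)ᶜ ⟨?_, fun q hq hqB => ?_⟩ fun e => ?_
    · rw [SoftClosed, compl_compl]
      exact softOpen_softBall hd p ε
    · obtain ⟨e, he⟩ := h q hq
      exact he.not_gt (hqB e)
    · rw [(hd.2.1 p p).2 rfl e]
      exact hε e
  · rintro h C ⟨hC, hSC⟩
    by_contra hp
    obtain ⟨ε, hε, hB⟩ := hC p hp
    obtain ⟨q, hqS, hq⟩ := h ε hε
    exact hB hq (hSC hqS)
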